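/- Let F be a field of characteristic zero and let A be a finite subset of F with |A| ≥ 2. Then for every natural number n ≥ 1, |D_n(A)| ≥ (1/8) · |A|^{(log₂ n)/10}, where log₂ denotes the logarithm to base 2. -/

import Mathlib

/-- `detSet n A` is the set of all determinants of `n × n` matrices with entries in `A`. -/
def detSet {F : Type*} [Field F] (n : ℕ) (A : Finset F) : Set F :=
  {d | ∃ M : Matrix (Fin n) (Fin n) F, (∀ i j, M i j ∈ A) ∧ M.det = d}

open Matrix in
/-- `x` equals `u ⬝ᵥ N⁻¹ *ᵥ v` for an `m × m` matrix `N` of determinant one, where all entries of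
`N`, `u` and `v` lie in `B`. -/
def HasBorderedRep {F : Type*} [Field F] (B : Set F) (m : ℕ) (x : F) : Prop :=
  ∃ (ι : Type) (_ : Fintype ι) (_ : DecidableEq ι) (N : Matrix ι ι F) (u v w : ι → F),
    Fintype.card ι = m ∧ (∀ i j, N i j ∈ B) ∧ (∀ i, u i ∈ B) ∧ (∀ i, v i ∈ B) ∧
      N.det = 1 ∧ N *ᵥ w = v ∧ u ⬝ᵥ w = x

namespace HasBorderedRep

open Matrix

variable {F : Type*} [Field F] {B : Set F} {m m' : ℕ} {x y : F}

theorem of_mem (h1 : (1 : F) ∈ B) (hx : x ∈ B) : HasBorderedRep B 1 x := by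
  refine ⟨Unit, inferInstance, inferInstance, 1, fun _ => x, fun _ => 1, fun _ => 1, rfl, ?_,
    fun _ => hx, fun _ => h1, by simp, by ext; simp, by simp⟩
  intro i j
  simpa [Subsingleton.elim i j] using h1

theorem add (h0 : (0 : F) ∈ B) (hx : HasBorderedRep B m x) (hy : HasBorderedRep B m' y) :
    HasBorderedRep B (m + m') (x + y) := by
  obtain ⟨ι, _, _, N, u, v, w, hc, hN, hu, hv, hd, hw, rfl⟩ := hx
  obtain ⟨κ, _, _, N', u', v', w', hc', hN', hu', hv', hd', hw', rfl⟩ := hy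
  refine ⟨ι ⊕ κ, inferInstance, inferInstance, fromBlocks N 0 0 N', Sum.elim u u', Sum.elim v v',
    Sum.elim w w', by simp [hc, hc'], ?_, ?_, ?_, by simp [hd, hd'], ?_, by simp⟩
  · rintro (i | i) (j | j) <;> simp [*]
  · rintro (i | i) <;> simp [*]
  · rintro (i | i) <;> simp [*]
  · simp [fromBlocks_mulVec, hw, hw']

theorem neg (h0 : (0 : F) ∈ B) (h1 : (1 : F) ∈ B) (hx : HasBorderedRep B m x) :
    HasBorderedRep B (m + 1) (-x) := by
  obtain ⟨ι, _, _, N, u, v, w, hc, hN, hu, hv, hd, hw, rfl⟩ := hx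
  refine ⟨ι ⊕ Unit, inferInstance, inferInstance, fromBlocks N 0 (replicateRow Unit u) 1,
    Sum.elim 0 1, Sum.elim v 0, Sum.elim w (fun _ => -(u ⬝ᵥ w)), by simp [hc], ?_, ?_, ?_,
    by simp [hd], ?_, by simp⟩
  · rintro (i | i) (j | j) <;> simp [*]
  · rintro (i | i) <;> simp [*]
  · rintro (i | i) <;> simp [*]
  · ext (i | i)
    · simp [fromBlocks_mulVec, hw]
    · simp only [fromBlocks_mulVec, Sum.elim_comp_inl, Sum.elim_comp_inr, one_mulVec]
      exact add_neg_cancel (u ⬝ᵥ w)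

theorem mul (h0 : (0 : F) ∈ B) (h1 : (1 : F) ∈ B) (hx : HasBorderedRep B m x)
    (hy : HasBorderedRep B m' y) : HasBorderedRep B (m + m' + 1) (x * y) := by
  obtain ⟨ι, _, _, N, u, v, w, hc, hN, hu, hv, hd, hw, rfl⟩ := hx
  obtain ⟨κ, _, _, N', u', v', w', hc', hN', hu', hv', hd', hw', rfl⟩ := hy
  refine ⟨ι ⊕ (κ ⊕ Unit), inferInstance, inferInstance,
    fromBlocks N (of fun i => Sum.elim 0 fun _ => v i) 0
      (fromBlocks N' 0 (replicateRow Unit u') 1),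
    Sum.elim u 0, Sum.elim 0 (Sum.elim v' 0),
    Sum.elim ((u' ⬝ᵥ w') • w) (Sum.elim w' fun _ => -(u' ⬝ᵥ w')),
    by simp [hc, hc', add_assoc], ?_, ?_, ?_, by simp [hd, hd'], ?_, by simp [mul_comm]⟩
  · rintro (i | i | i) (j | j | j) <;> simp [*]
  · rintro (i | i | i) <;> simp [*]
  · rintro (i | i | i) <;> simp [*]
  · ext (i | i | i)
    · have : ((of fun i => Sum.elim (0 : κ → F) fun _ : Unit => v i) *ᵥ
          Sum.elim w' fun _ => -(u' ⬝ᵥ w')) i = -(v i * (u' ⬝ᵥ w')) := by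
        simp [mulVec, dotProduct]
      simp [fromBlocks_mulVec, mulVec_smul, hw, this, mul_comm]
    · simp [fromBlocks_mulVec, hw']
    · simp only [fromBlocks_mulVec, Sum.elim_comp_inl, Sum.elim_comp_inr, zero_mulVec, zero_add,
        Sum.elim_inr, one_mulVec]
      exact add_neg_cancel (u' ⬝ᵥ w')

theorem mono (h0 : (0 : F) ∈ B) (h1 : (1 : F) ∈ B) (hx : HasBorderedRep B m x) (h : m ≤ m') :
    HasBorderedRep B m' x := by
  induction m', h using Nat.le_induction with
  | base => exact hx
  | succ k _ ih => simpa using ih.add h0 (of_mem h1 h0)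

/-- If `B` is the preimage of `A` under `z ↦ b + c * z`, then the elements with a bordered
representation over `B` give determinants over `A`, up to a common factor. -/
theorem mul_mem_detSet {A : Finset F} {a b c : F} (ha : a ∈ A) (ha0 : a ≠ 0) (hb : b ∈ A)
    (hx : HasBorderedRep {z | b + c * z ∈ A} m x) :
    -(a * c ^ (m + 1)) * x ∈ detSet (m + 2) A := by
  obtain ⟨ι, _, _, N, u, v, w, hc, hN, hu, hv, hd, hw, rfl⟩ := hx
  have hM : (fromBlocks N (replicateCol Unit v) (replicateRow Unit u) 0).det = -(u ⬝ᵥ w) := by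
    have : Invertible N := invertibleOfIsUnitDet N (by simp [hd])
    rw [det_fromBlocks₁₁, hd, ← hw, Matrix.replicateCol_mulVec, Matrix.mul_assoc,
      Matrix.invOf_mul_cancel_left]
    simp
  set M := fromBlocks N (replicateCol Unit v) (replicateRow Unit u) 0 with hMdef
  have hMA : ∀ i j, b + c * M i j ∈ A := by
    rintro (i | i) (j | j)
    · exact hN i j
    · exact hv i
    · exact hu j
    · simpa [hMdef] using hb
  let K : Matrix (Unit ⊕ (ι ⊕ Unit)) (Unit ⊕ (ι ⊕ Unit)) F :=
    fromBlocks (of fun _ _ => a) (of fun _ _ => a) (of fun _ _ => b) (of fun i j => b + c * M i j)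
  have hK : K.det = -(a * c ^ (m + 1)) * (u ⬝ᵥ w) := by
    have hdet : (of fun _ _ : Unit => a).det = a := by simp
    have : Invertible (of fun _ _ : Unit => a) :=
      invertibleOfIsUnitDet _ (by rw [hdet]; exact ha0.isUnit)
    have hrow : (of fun (_ : Unit) (_ : ι ⊕ Unit) => a) =
        (of fun _ _ : Unit => a) * of fun (_ : Unit) (_ : ι ⊕ Unit) => (1 : F) := by
      ext; simp [Matrix.mul_apply]
    have hsub : (of fun i j => b + c * M i j) - (of fun (_ : ι ⊕ Unit) (_ : Unit) => b) *
        (of fun (_ : Unit) (_ : ι ⊕ Unit) => (1 : F)) = c • M := by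
      ext i j; simp [Matrix.mul_apply]
    rw [det_fromBlocks₁₁, hrow, Matrix.mul_assoc, Matrix.invOf_mul_cancel_left, hsub, det_smul, hM, hdet]
    simp [hc]
    ring
  have hcard : Fintype.card (Unit ⊕ (ι ⊕ Unit)) = m + 2 := by simp [hc]; ring
  let e := Fintype.equivFinOfCardEq hcard
  refine ⟨reindex e e K, fun i j => ?_, by rw [det_reindex_self, hK]⟩
  rw [reindex_apply, submatrix_apply]
  rcases e.symm i with i | i <;> rcases e.symm j with j | j
  · exact ha
  · exact ha
  · exact hb
  · exact hMA i j

end HasBorderedRep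

/-- In characteristic zero, the quotient set of `X - X` is not stable under adding one, which
produces an injective linear form on `X × X`. -/
theorem exists_injOn_linear_form {F : Type*} [Field F] [CharZero F] (X : Finset F)
    (hX : 2 ≤ X.card) :
    ∃ a ∈ X, ∃ b ∈ X, ∃ c ∈ X, ∃ d ∈ X,
      Set.InjOn (fun p : F × F => (c - d) * p.1 + (a - b + (c - d)) * p.2) (X ×ˢ X : Finset _) := by
  classical
  let Q : Set F := {q | ∃ a ∈ X, ∃ b ∈ X, ∃ c ∈ X, ∃ d ∈ X, c ≠ d ∧ (a - b) / (c - d) = q}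
  have hQfin : Q.Finite := by
    refine ((X ×ˢ X ×ˢ X ×ˢ X).image
      fun p => (p.1 - p.2.1) / (p.2.2.1 - p.2.2.2)).finite_toSet.subset ?_
    rintro q ⟨a, ha, b, hb, c, hc, d, hd, -, rfl⟩
    simp only [Finset.coe_image, Set.mem_image]
    exact ⟨(a, b, c, d), by simp [*], rfl⟩
  obtain ⟨s, hs, t, ht, hst⟩ := Finset.one_lt_card.mp hX
  obtain ⟨q, ⟨a, ha, b, hb, c, hc, d, hd, hcd, rfl⟩, hq⟩ : ∃ q ∈ Q, q + 1 ∉ Q := by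
    by_contra! h
    have hnat : ∀ n : ℕ, (n : F) ∈ Q := by
      intro n
      induction n with
      | zero => exact ⟨s, hs, s, hs, s, hs, t, ht, hst, by simp⟩
      | succ n ih => exact_mod_cast h _ ih
    exact Set.infinite_range_of_injective Nat.cast_injective
      (hQfin.subset (Set.range_subset_iff.mpr hnat))
  refine ⟨a, ha, b, hb, c, hc, d, hd, ?_⟩
  rintro ⟨x, y⟩ hxy ⟨x', y'⟩ hxy' heq
  simp only [Finset.coe_product, Set.mem_prod, Finset.mem_coe] at hxy hxy' heq
  have hcd' : c - d ≠ 0 := sub_ne_zero.mpr hcd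
  by_cases hy : y = y'
  · subst hy
    have := mul_left_cancel₀ hcd' (add_right_cancel heq)
    rw [this]
  · refine absurd ⟨x, hxy.1, x', hxy'.1, y', hxy'.2, y, hxy.2, Ne.symm hy, ?_⟩ hq
    have : y' - y ≠ 0 := sub_ne_zero.mpr (Ne.symm hy)
    field_simp
    linear_combination heq

theorem exists_card_eq_pow_of_hasBorderedRep {F : Type*} [Field F] [CharZero F] (B : Finset F)
    (h0 : 0 ∈ B) (h1 : 1 ∈ B) (j : ℕ) :
    ∃ X : Finset F, X.card = B.card ^ 2 ^ j ∧
      ∀ x ∈ X, HasBorderedRep (B : Set F) (2 * 8 ^ j - 1) x := by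
  classical
  have hB : 2 ≤ B.card := Finset.one_lt_card.mpr ⟨0, h0, 1, h1, zero_ne_one⟩
  induction j with
  | zero => exact ⟨B, by simp, fun x hx => .of_mem (Finset.mem_coe.mpr h1) hx⟩
  | succ j ih =>
    obtain ⟨X, hXcard, hX⟩ := ih
    have hX2 : 2 ≤ X.card := hXcard ▸ hB.trans (Nat.le_self_pow (by positivity) _)
    obtain ⟨a, ha, b, hb, c, hc, d, hd, hinj⟩ := exists_injOn_linear_form X hX2
    refine ⟨_, (Finset.card_image_of_injOn hinj).trans ?_, ?_⟩
    · rw [Finset.card_product, hXcard]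
      ring
    · have g0 : (0 : F) ∈ (B : Set F) := h0
      have g1 : (1 : F) ∈ (B : Set F) := h1
      have hsub : ∀ {s t}, s ∈ X → t ∈ X →
          HasBorderedRep (B : Set F) (2 * 8 ^ j - 1 + (2 * 8 ^ j - 1 + 1)) (s - t) := by
        intro s t hs ht
        rw [sub_eq_add_neg]
        exact (hX s hs).add g0 ((hX t ht).neg g0 g1)
      intro z hz
      obtain ⟨⟨x, y⟩, hxy, rfl⟩ := Finset.mem_image.mp hz
      obtain ⟨hx, hy⟩ := Finset.mem_product.mp hxy
      refine (((hsub hc hd).mul g0 g1 (hX x hx)).add g0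
        (((hsub ha hb).add g0 (hsub hc hd)).mul g0 g1 (hX y hy))).mono g0 g1 ?_
      have := Nat.one_le_pow j 8 (by norm_num)
      rw [pow_succ]
      omega

theorem finite_detSet {F : Type*} [Field F] (n : ℕ) (A : Finset F) : (detSet n A).Finite := by
  have h : {M : Matrix (Fin n) (Fin n) F | ∀ i j, M i j ∈ A}.Finite := by
    have := Set.Finite.pi' fun _ : Fin n => Set.Finite.pi' fun _ : Fin n => A.finite_toSet
    exact this
  exact h.image Matrix.det

theorem card_pow_le_ncard_detSet {F : Type*} [Field F] [CharZero F] (A : Finset F)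
    (hA : 2 ≤ A.card) {n j : ℕ} (hn : 2 * 8 ^ j + 1 ≤ n) :
    A.card ^ 2 ^ j ≤ (detSet n A).ncard := by
  classical
  obtain ⟨a, ha, ha0⟩ := Finset.exists_mem_ne hA 0
  obtain ⟨b, hb⟩ : A.Nonempty := ⟨a, ha⟩
  obtain ⟨c, hc, hcb⟩ := Finset.exists_mem_ne hA b
  have hcb' : c - b ≠ 0 := sub_ne_zero.mpr hcb
  let f : F → F := fun z => (z - b) / (c - b)
  have hf : Function.Injective f := fun x y h => by
    simpa [f, div_left_inj' hcb'] using h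
  have hBA : ((A.image f : Finset F) : Set F) ⊆ {z | b + (c - b) * z ∈ A} := by
    intro z hz
    obtain ⟨y, hy, rfl⟩ := Finset.mem_image.mp (Finset.mem_coe.mp hz)
    have : b + (c - b) * f y = y := by simp only [f]; field_simp; ring
    simpa [this] using hy
  obtain ⟨X, hXcard, hX⟩ := exists_card_eq_pow_of_hasBorderedRep (A.image f)
    (Finset.mem_image.mpr ⟨b, hb, by simp [f]⟩)
    (Finset.mem_image.mpr ⟨c, hc, by simp [f, hcb']⟩) j
  rw [Finset.card_image_of_injective _ hf] at hXcard
  have g0 : (0 : F) ∈ {z | b + (c - b) * z ∈ A} := by simpa using hb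
  have g1 : (1 : F) ∈ {z | b + (c - b) * z ∈ A} := by simpa using hc
  obtain ⟨m, rfl⟩ : ∃ m, n = m + 2 := ⟨n - 2, by have := Nat.one_le_pow j 8 (by norm_num); omega⟩
  have hk : -(a * (c - b) ^ (m + 1)) ≠ 0 := by simp [ha0, hcb']
  rw [← hXcard, ← Finset.card_image_of_injective X (mul_right_injective₀ hk),
    ← Set.ncard_coe_finset]
  refine Set.ncard_le_ncard ?_ (finite_detSet _ _)
  intro z hz
  obtain ⟨x, hx, rfl⟩ := Finset.mem_image.mp (Finset.mem_coe.mp hz)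
  refine HasBorderedRep.mul_mem_detSet ha ha0 hb (HasBorderedRep.mono g0 g1 ?_
    (show 2 * 8 ^ j - 1 ≤ m by omega))
  obtain ⟨ι, i₁, i₂, N, u, v, w, h, hN, hu, hv, h'⟩ := hX x hx
  exact ⟨ι, i₁, i₂, N, u, v, w, h, fun i j => hBA (hN i j), fun i => hBA (hu i),
    fun i => hBA (hv i), h'⟩

theorem card_le_ncard_detSet_one {F : Type*} [Field F] (A : Finset F) :
    A.card ≤ (detSet 1 A).ncard := by
  rw [← Set.ncard_coe_finset]
  refine Set.ncard_le_ncard (fun x hx => ?_) (finite_detSet _ _)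
  exact ⟨Matrix.of fun _ _ => x, fun _ _ => hx, by simp⟩

theorem card_le_ncard_detSet_two {F : Type*} [Field F] (A : Finset F) (hA : 2 ≤ A.card) :
    A.card ≤ (detSet 2 A).ncard := by
  classical
  obtain ⟨a, ha, ha0⟩ := Finset.exists_mem_ne hA 0
  have hf : Function.Injective fun x : F => a * x - a * a := fun x y h =>
    mul_left_cancel₀ ha0 (sub_left_injective h)
  rw [← Finset.card_image_of_injective A hf, ← Set.ncard_coe_finset]
  refine Set.ncard_le_ncard (fun z hz => ?_) (finite_detSet _ _)
  obtain ⟨x, hx, rfl⟩ := Finset.mem_image.mp (Finset.mem_coe.mp hz)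
  refine ⟨!![a, a; a, x], fun i j => ?_, by simp [Matrix.det_fin_two]⟩
  fin_cases i <;> fin_cases j <;> simp [ha, hx]

theorem exists_card_pow_le_ncard_detSet {F : Type*} [Field F] [CharZero F] (A : Finset F)
    (hA : 2 ≤ A.card) {n : ℕ} (hn : 1 ≤ n) :
    ∃ j : ℕ, n ≤ 16 * 8 ^ j ∧ A.card ^ 2 ^ j ≤ (detSet n A).ncard := by
  rcases (by omega : n = 1 ∨ n = 2 ∨ 3 ≤ n) with rfl | rfl | h3
  · exact ⟨0, by simp, by simpa using card_le_ncard_detSet_one A⟩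
  · exact ⟨0, by simp, by simpa using card_le_ncard_detSet_two A hA⟩
  · refine ⟨Nat.log 8 ((n - 1) / 2), ?_, card_pow_le_ncard_detSet A hA ?_⟩
    · have := Nat.lt_pow_succ_log_self (by norm_num : 1 < 8) ((n - 1) / 2)
      rw [pow_succ] at this
      omega
    · have := Nat.pow_log_le_self 8 (by omega : (n - 1) / 2 ≠ 0)
      omega

/-- For a field `F` of characteristic zero, `A ⊆ F` with `|A| ≥ 2`, and every `n ≥ 1`,
`|D_n(A)| ≥ (1/8) · |A|^{(log₂ n)/10}`. -/
theorem card_detSet_ge_rpow_logb_charZero {F : Type*} [Field F] [CharZero F]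
    (A : Finset F) (hA : 2 ≤ A.card) :
    ∀ n : ℕ, 1 ≤ n →
      (1 / 8 : ℝ) * (A.card : ℝ) ^ (Real.logb 2 n / 10) ≤ ((detSet n A).ncard : ℝ) := by
  intro n hn
  obtain ⟨j, hnj, hj⟩ := exists_card_pow_le_ncard_detSet A hA hn
  have hlog : Real.logb 2 n ≤ 4 + 3 * j := by
    rw [Real.logb_le_iff_le_rpow (by norm_num) (by exact_mod_cast hn)]
    have h : ((2 : ℝ) ^ (4 + 3 * j : ℝ)) = 16 * 8 ^ j := by
      rw [show (4 + 3 * j : ℝ) = ((4 + 3 * j : ℕ) : ℝ) by push_cast; ring, Real.rpow_natCast,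
        pow_add, pow_mul]
      norm_num
    rw [h]
    exact_mod_cast hnj
  have hexp : Real.logb 2 n / 10 ≤ ((2 ^ j : ℕ) : ℝ) := by
    have h : (j : ℝ) + 1 ≤ ((2 ^ j : ℕ) : ℝ) := by exact_mod_cast Nat.lt_two_pow_self
    linarith [(Nat.cast_nonneg j : (0 : ℝ) ≤ j)]
  calc (1 / 8 : ℝ) * (A.card : ℝ) ^ (Real.logb 2 n / 10)
      ≤ (A.card : ℝ) ^ (Real.logb 2 n / 10) := by
        linarith [Real.rpow_nonneg (Nat.cast_nonneg A.card : (0 : ℝ) ≤ A.card)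
          (Real.logb 2 n / 10)]
    _ ≤ (A.card : ℝ) ^ ((2 ^ j : ℕ) : ℝ) :=
        Real.rpow_le_rpow_of_exponent_le (by exact_mod_cast (by omega : 1 ≤ A.card)) hexp
    _ ≤ (detSet n A).ncard := by
        rw [Real.rpow_natCast]
        exact_mod_cast hj
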